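/- Let n ≥ 3 and let x be an integer with 1 < x < n. If n ≡ 0 (mod 3), x ≡ 1 (mod 3), and 3x ≤ 2n, then the 5-regular circulant graph C_{2n}(x,1,n) is word-representable. -/

import Mathlib

/-- Two letters `x` and `y` alternate in the word `w` if, after deleting all letters
other than `x` and `y`, no two consecutive letters of the resulting word are equal. -/
def Alternate {V : Type*} [DecidableEq V] (w : List V) (x y : V) : Prop :=
  (w.filter (fun z => decide (z = x ∨ z = y))).Chain' (· ≠ ·)

/-- A word `w` represents the graph `G` if it contains every vertex at least once and
two distinct vertices are adjacent in `G` iff they alternate in `w`. -/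
def Represents {V : Type*} [DecidableEq V] (G : SimpleGraph V) (w : List V) : Prop :=
  (∀ v : V, v ∈ w) ∧ ∀ x y : V, x ≠ y → (G.Adj x y ↔ Alternate w x y)

/-- A graph is word-representable if some word represents it. -/
def WordRepresentable {V : Type*} [DecidableEq V] (G : SimpleGraph V) : Prop :=
  ∃ w : List V, Represents G w

/-- A word is `k`-uniform if every letter of the alphabet occurs in it exactly `k` times. -/
def IsKUniform {V : Type*} [DecidableEq V] (w : List V) (k : ℕ) : Prop :=
  ∀ v : V, w.count v = k

open scoped Classical in
/-- The vertices satisfying `p`, each listed once. -/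
noncomputable def vertexList {V : Type*} [Fintype V] (p : V → Prop) : List V :=
  Finset.univ.toList.filter (fun z => decide (p z))

/-- The word obtained from `w` by deleting all letters other than `x` and `y`. -/
def restrictTo {V : Type*} [DecidableEq V] (x y : V) (w : List V) : List V :=
  w.filter (fun z => decide (z = x ∨ z = y))

theorem isChain_flatten_replicate_pair {V : Type*} {x y : V} (hxy : x ≠ y) (k : ℕ) :
    (List.replicate k [x, y]).flatten.IsChain (· ≠ ·) := by
  induction k with
  | zero => simp
  | succ k ih =>
    cases k with
    | zero => simpa using hxy
    | succ k =>
      simp only [List.replicate_succ, List.flatten_cons, List.cons_append, List.nil_append] at ih ⊢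
      exact .cons_cons hxy (.cons_cons hxy.symm ih)

section Words

variable {V : Type*} [DecidableEq V]

theorem restrictTo_append (x y : V) (u w : List V) :
    restrictTo x y (u ++ w) = restrictTo x y u ++ restrictTo x y w :=
  List.filter_append ..

theorem restrictTo_comm (x y : V) (w : List V) : restrictTo x y w = restrictTo y x w := by
  simp only [restrictTo, or_comm]

theorem Alternate.of_infix {x y : V} {u w : List V} (h : Alternate w x y) (huw : u <:+: w) :
    Alternate u x y :=
  List.IsChain.infix h (huw.filter _)

theorem Alternate.symm {x y : V} {w : List V} (h : Alternate w x y) : Alternate w y x := by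
  unfold Alternate at *
  simpa only [or_comm] using h

theorem List.filter_eq_ite_of_nodup {l : List V} (hl : l.Nodup) {x : V} (hx : x ∈ l)
    {q : V → Bool} {p : Prop} [Decidable p] (h : ∀ z, q z = true ↔ z = x ∧ p) :
    l.filter q = if p then [x] else [] := by
  split_ifs with hp
  · have : q = fun z => z == x := by
      funext z
      rw [Bool.eq_iff_iff, h]
      simp [hp]
    rw [this, List.filter_beq, List.count_eq_one_of_mem hl hx]
    rfl
  · exact List.filter_eq_nil_iff.2 fun z _ hz => hp ((h z).1 hz).2

variable [Fintype V]

open scoped Classical in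
theorem restrictTo_vertexList {x y : V} {p : V → Prop} (h : ¬ (p x ∧ p y)) :
    restrictTo x y (vertexList p) =
      (if p x then [x] else []) ++ (if p y then [y] else []) := by
  have left (x y : V) (hy : ¬ p y) :
      restrictTo x y (vertexList p) = if p x then [x] else [] := by
    unfold restrictTo vertexList
    rw [List.filter_filter]
    exact List.filter_eq_ite_of_nodup (Finset.nodup_toList _) (by simp) fun z => by grind
  by_cases hy : p y
  · rw [restrictTo_comm, left y x fun hx => h ⟨hx, hy⟩, if_neg fun hx => h ⟨hx, hy⟩,
      List.nil_append]
  · rw [left x y hy, if_neg hy, List.append_nil]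

end Words

section ThreeColorable

variable {V : Type*} [Fintype V] (G : SimpleGraph V) (c : V → Fin 3)

/-- A word that orders the colour classes increasingly and lets a vertex `v` of colour `0` fail to
alternate with each of its nonneighbours. -/
noncomputable def lowBlock (v : V) : List V :=
  vertexList (· = v) ++ vertexList (fun z => c z = 0 ∧ z ≠ v) ++ vertexList (fun z => c z = 1) ++
  vertexList (fun z => c z = 2 ∧ G.Adj v z) ++ vertexList (· = v) ++
  vertexList (fun z => c z = 2 ∧ ¬ G.Adj v z) ++ vertexList (fun z => c z = 0 ∧ z ≠ v) ++
  vertexList (fun z => c z = 1) ++ vertexList (fun z => c z = 2) ++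
  vertexList (fun z => c z = 0 ∧ z ≠ v) ++ vertexList (fun z => c z = 1 ∧ ¬ G.Adj v z) ++
  vertexList (· = v) ++ vertexList (fun z => c z = 1 ∧ G.Adj v z) ++ vertexList (fun z => c z = 2)

/-- A word that orders the colour classes increasingly and lets a vertex `v` of colour `1` fail to
alternate with the other vertices of colour `1`. -/
noncomputable def middleBlock (v : V) : List V :=
  vertexList (fun z => c z = 0) ++ vertexList (· = v) ++ vertexList (fun z => c z = 1 ∧ z ≠ v) ++
  vertexList (fun z => c z = 2) ++
  vertexList (fun z => c z = 0) ++ vertexList (fun z => c z = 1 ∧ z ≠ v) ++ vertexList (· = v) ++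
  vertexList (fun z => c z = 2)

/-- A word that orders the colour classes increasingly and lets a vertex `v` of colour `2` fail to
alternate with each of its nonneighbours of colour `1` or `2`. -/
noncomputable def highBlock (v : V) : List V :=
  vertexList (fun z => c z = 0) ++ vertexList (fun z => c z = 1 ∧ G.Adj v z) ++ vertexList (· = v) ++
  vertexList (fun z => c z = 1 ∧ ¬ G.Adj v z) ++ vertexList (fun z => c z = 2 ∧ z ≠ v) ++
  vertexList (fun z => c z = 0) ++ vertexList (fun z => c z = 1) ++
  vertexList (fun z => c z = 2 ∧ z ≠ v) ++ vertexList (· = v)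

/-- The block of a vertex, chosen according to its colour. -/
noncomputable def colorBlock (v : V) : List V :=
  if c v = 0 then lowBlock G c v else if c v = 1 then middleBlock c v else highBlock G c v

variable {G c}

theorem mem_colorBlock (v : V) : v ∈ colorBlock G c v := by
  unfold colorBlock lowBlock middleBlock highBlock
  split_ifs <;> simp [vertexList]

variable [DecidableEq V]

theorem exists_restrictTo_colorBlock {x y : V} (h : G.Adj x y) (hlt : c x < c y) (v : V) :
    ∃ k, restrictTo x y (colorBlock G c v) = (List.replicate k [x, y]).flatten := by
  have hne := h.ne
  have hadj := h.symm
  have hxy : c x = 0 ∧ c y = 1 ∨ c x = 0 ∧ c y = 2 ∨ c x = 1 ∧ c y = 2 := by omega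
  refine ⟨if c v = 0 then 3 else 2, ?_⟩
  rcases (by omega : c v = 0 ∨ c v = 1 ∨ c v = 2) with hv | hv | hv
  all_goals
    simp (disch := grind) only [colorBlock, lowBlock, middleBlock, highBlock, hv, if_true,
      Fin.reduceEq, if_false, restrictTo_append, restrictTo_vertexList]
    rcases hxy with ⟨hx, hy⟩ | ⟨hx, hy⟩ | ⟨hx, hy⟩ <;>
    by_cases hxv : x = v <;> by_cases hyv : y = v <;>
    by_cases hvx : G.Adj v x <;> by_cases hvy : G.Adj v y <;>
    simp_all [List.replicate]

theorem not_alternate_colorBlock {v y : V} (hvy : v ≠ y) (h : ¬ G.Adj v y)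
    (hc : c v = c y ∨ c v = 0 ∨ c v = 2 ∧ c y = 1) : ¬ Alternate (colorBlock G c v) v y := by
  change ¬ (restrictTo v y (colorBlock G c v)).IsChain _
  have hy : c y = 0 ∨ c y = 1 ∨ c y = 2 := by omega
  rcases (by omega : c v = 0 ∨ c v = 1 ∨ c v = 2) with hv | hv | hv
  all_goals
    simp (disch := grind) only [colorBlock, lowBlock, middleBlock, highBlock, hv, if_true,
      Fin.reduceEq, if_false, restrictTo_append, restrictTo_vertexList]
    rcases hy with hy | hy | hy <;> simp_all [hvy.symm]

theorem wordRepresentable_of_coloring (hc : ∀ x y, G.Adj x y → c x ≠ c y) :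
    WordRepresentable G := by
  refine ⟨Finset.univ.toList.flatMap (colorBlock G c),
    fun v => List.mem_flatMap.2 ⟨v, by simp, mem_colorBlock v⟩,
    fun x y hxy => ⟨fun h => ?_, fun h => ?_⟩⟩
  · have key : ∀ x y, G.Adj x y → c x < c y → ∀ l : List V,
        Alternate (l.flatMap (colorBlock G c)) x y := by
      intro x y h hlt l
      suffices ∃ k, restrictTo x y (l.flatMap (colorBlock G c)) =
          (List.replicate k [x, y]).flatten by
        obtain ⟨k, hk⟩ := this
        change (restrictTo x y _).IsChain _
        exact hk ▸ isChain_flatten_replicate_pair h.ne k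
      induction l with
      | nil => exact ⟨0, rfl⟩
      | cons v l ih =>
        obtain ⟨k, hk⟩ := ih
        obtain ⟨j, hj⟩ := exists_restrictTo_colorBlock h hlt v
        exact ⟨j + k, by rw [List.flatMap_cons, restrictTo_append, hk, hj, List.replicate_add,
          List.flatten_append]⟩
    rcases lt_or_gt_of_ne (hc x y h) with hlt | hlt
    · exact key x y h hlt _
    · exact (key y x h.symm hlt _).symm
  · by_contra hadj
    have hinf (v : V) : colorBlock G c v <:+: Finset.univ.toList.flatMap (colorBlock G c) :=
      List.infix_flatMap_of_mem (by simp) _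
    have hcol : (c x = c y ∨ c x = 0 ∨ c x = 2 ∧ c y = 1) ∨
        (c y = c x ∨ c y = 0 ∨ c y = 2 ∧ c x = 1) := by omega
    rcases hcol with hcol | hcol
    · exact not_alternate_colorBlock hxy hadj hcol (h.of_infix (hinf x))
    · exact not_alternate_colorBlock hxy.symm (fun h => hadj h.symm) hcol
        (h.symm.of_infix (hinf y))

end ThreeColorable


theorem stmt18 (n x : ℕ) (hn : 3 ≤ n) (hx1 : 1 < x) (hxn : x < n)
    (h0 : n % 3 = 0) (h1 : x % 3 = 1) (h2 : 3*x ≤ 2*n) :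
    WordRepresentable (SimpleGraph.circulantGraph {((1 : ℕ) : ZMod (2*n)), ((x : ℕ) : ZMod (2*n)), ((n : ℕ) : ZMod (2*n))}) := by
  have : NeZero (2 * n) := ⟨by omega⟩
  obtain ⟨m, rfl⟩ : ∃ m, n = 3 * m := ⟨n / 3, by omega⟩
  let f : ℕ → ℕ := fun i => if i < 2 * m then i else if i < 4 * m then i + 1 else i + 2
  have hf : ∀ d, d = 1 ∨ d = x ∨ d = 3 * m → ∀ i < 2 * (3 * m),
      f ((i + d) % (2 * (3 * m))) % 3 ≠ f i % 3 := by
    intro d hd i hi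
    have hmod : (i + d) % (2 * (3 * m)) = i + d ∧ i + d < 2 * (3 * m) ∨
        (i + d) % (2 * (3 * m)) + 2 * (3 * m) = i + d ∧ 2 * (3 * m) ≤ i + d := by
      rcases lt_or_ge (i + d) (2 * (3 * m)) with h | h
      · exact .inl ⟨Nat.mod_eq_of_lt h, h⟩
      · right
        rw [Nat.mod_eq_sub_mod h, Nat.mod_eq_of_lt (by omega)]
        omega
    generalize (i + d) % (2 * (3 * m)) = j at *
    simp only [f]
    split_ifs <;> omega
  have hadj : ∀ d, d = 1 ∨ d = x ∨ d = 3 * m → ∀ a b : ZMod (2 * (3 * m)), a - b = (d : ℕ) →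
      f a.val % 3 ≠ f b.val % 3 := by
    intro d hd a b hab
    have ha : a = ((b.val + d : ℕ) : ZMod (2 * (3 * m))) := by
      rw [Nat.cast_add, ← hab, ZMod.natCast_zmod_val]
      ring
    have hav : a.val = (b.val + d) % (2 * (3 * m)) := by
      rw [ha, ZMod.val_natCast]
    rw [hav]
    exact hf d hd _ (ZMod.val_lt b)
  refine wordRepresentable_of_coloring (c := fun v => Fin.ofNat 3 (f v.val)) fun a b h => ?_
  rw [Ne, Fin.ext_iff]
  change f a.val % 3 ≠ f b.val % 3
  simp only [SimpleGraph.circulantGraph, SimpleGraph.fromRel_adj, Set.mem_insert_iff,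
    Set.mem_singleton_iff] at h
  rcases h.2 with (h | h | h) | (h | h | h)
  · exact hadj 1 (by simp) a b h
  · exact hadj x (by simp) a b h
  · exact hadj (3 * m) (by simp) a b h
  · exact (hadj 1 (by simp) b a h).symm
  · exact (hadj x (by simp) b a h).symm
  · exact (hadj (3 * m) (by simp) b a h).symm
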